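/- arXiv:2602.06746 — 2 statements merged into one kernel-verified Lean document; each statement's English description precedes it below -/
import Mathlib

section
/- Progression to tt certifies satisfaction and progression to ff certifies violation: let prog*(φ, u) denote the result of progressing φ successively through the letters of the finite word u. For every LTL formula φ, every ω-word w, and every n ∈ ℕ: if prog*(φ, [w(0), …, w(n−1)]) is syntactically equal to tt then w ⊨ φ, and if it is syntactically equal to ff then w ⊭ φ. -/
inductive LTL (AP : Type) : Type where
  | tt : LTL AP
  | atom : AP → LTL AP
  | not : LTL AP → LTL AP
  | and : LTL AP → LTL AP → LTL AP
  | next : LTL AP → LTL AP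
  | untl : LTL AP → LTL AP → LTL AP

/-- The suffix `w_i` of an ω-word `w : ℕ → 2^AP`. -/
def wsuffix {AP : Type} (w : ℕ → Set AP) (i : ℕ) : ℕ → Set AP := fun n => w (n + i)

/-- The LTL satisfaction relation `w ⊨ φ`. -/
def Sat {AP : Type} : LTL AP → (ℕ → Set AP) → Prop
  | .tt, _ => True
  | .atom a, w => a ∈ w 0
  | .not φ, w => ¬ Sat φ w
  | .and φ ψ, w => Sat φ w ∧ Sat ψ w
  | .next φ, w => Sat φ (wsuffix w 1)
  | .untl φ ψ, w => ∃ k, Sat ψ (wsuffix w k) ∧ ∀ j < k, Sat φ (wsuffix w j)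

open Classical in
/-- Formula progression `prog(φ, σ)`, with `ff := ¬tt` and `φ ∨ ψ := ¬(¬φ ∧ ¬ψ)`. -/
noncomputable def prog {AP : Type} : LTL AP → Set AP → LTL AP
  | .tt, _ => .tt
  | .atom a, σ => if a ∈ σ then .tt else .not .tt
  | .not φ, σ => .not (prog φ σ)
  | .and φ ψ, σ => .and (prog φ σ) (prog ψ σ)
  | .next φ, _ => φ
  | .untl φ ψ, σ =>
      .not (.and (.not (prog ψ σ)) (.not (.and (prog φ σ) (.untl φ ψ))))

/-- Iterated formula progression `prog*(φ, u)` through a finite word `u`. -/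
noncomputable def progs {AP : Type} : LTL AP → List (Set AP) → LTL AP
  | φ, [] => φ
  | φ, σ :: u => progs (prog φ σ) u

theorem wsuffix_wsuffix {AP : Type} (w : ℕ → Set AP) (i j : ℕ) :
    wsuffix (wsuffix w i) j = wsuffix w (j + i) := by
  funext n
  simp only [wsuffix, Nat.add_assoc]

theorem sat_untl_iff {AP : Type} (φ ψ : LTL AP) (w : ℕ → Set AP) :
    Sat (.untl φ ψ) w ↔ Sat ψ w ∨ (Sat φ w ∧ Sat (.untl φ ψ) (wsuffix w 1)) := by
  simp only [Sat, wsuffix_wsuffix]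
  constructor
  · rintro ⟨_ | k, hψ, hφ⟩
    · exact .inl hψ
    · exact .inr ⟨hφ 0 k.succ_pos, k, hψ, fun j hj => hφ (j + 1) (Nat.succ_lt_succ hj)⟩
  · rintro (hψ | ⟨h0, k, hψ, hφ⟩)
    · exact ⟨0, hψ, fun j hj => absurd hj j.not_lt_zero⟩
    · refine ⟨k + 1, hψ, fun j hj => ?_⟩
      cases j with
      | zero => exact h0
      | succ j => exact hφ j (Nat.lt_of_succ_lt_succ hj)

theorem sat_prog_iff {AP : Type} (φ : LTL AP) (w : ℕ → Set AP) :
    Sat (prog φ (w 0)) (wsuffix w 1) ↔ Sat φ w := by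
  induction φ with
  | tt => simp [prog, Sat]
  | atom a => by_cases h : a ∈ w 0 <;> simp [prog, Sat, h]
  | not φ ih => simp only [prog, Sat, ih]
  | and φ ψ ihφ ihψ => simp only [prog, Sat, ihφ, ihψ]
  | next φ _ => simp only [prog, Sat]
  | untl φ ψ ihφ ihψ =>
    rw [sat_untl_iff, prog, Sat, Sat, Sat, Sat, Sat, ihφ, ihψ]
    tauto

theorem sat_progs_iff {AP : Type} (φ : LTL AP) (w : ℕ → Set AP) (n : ℕ) :
    Sat (progs φ ((List.range n).map w)) (wsuffix w n) ↔ Sat φ w := by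
  induction n generalizing φ w with
  | zero => rfl
  | succ n ih =>
    have h := ih (prog φ (w 0)) (wsuffix w 1)
    rw [sat_prog_iff, wsuffix_wsuffix] at h
    rw [List.range_succ_eq_map, List.map_cons, List.map_map]
    exact h

/-- Progression to `tt` certifies satisfaction; progression to `ff = ¬tt` certifies violation. -/
theorem progs_tt_ff {AP : Type} (φ : LTL AP) (w : ℕ → Set AP) (n : ℕ) :
    (progs φ ((List.range n).map w) = .tt → Sat φ w) ∧
    (progs φ ((List.range n).map w) = .not .tt → ¬ Sat φ w) := by
  rw [← sat_progs_iff φ w n]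
  constructor <;> intro h <;> simp [h, Sat]
end

section
/- Exact characterization of constant-word satisfaction by obligation sets: for every LTL formula φ and every letter σ, the constant word σ^ω satisfies φ if and only if σ ∈ ob(φ). -/
/-- Obligation sets `ob(φ) ⊆ 2^AP`. -/
def ob {AP : Type} : LTL AP → Set (Set AP)
  | .tt => Set.univ
  | .atom a => {σ | a ∈ σ}
  | .not φ => Set.univ \ ob φ
  | .and φ ψ => ob φ ∩ ob ψ
  | .next φ => ob φ
  | .untl _ ψ => ob ψ

theorem wsuffix_const {AP : Type} (σ : Set AP) (i : ℕ) :
    wsuffix (fun _ => σ) i = fun _ => σ := rfl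

/-- Exact characterization: the constant word `σ^ω` satisfies `φ` iff `σ ∈ ob(φ)`. -/
theorem ob_iff {AP : Type} (φ : LTL AP) (σ : Set AP) :
    Sat φ (fun _ => σ) ↔ σ ∈ ob φ := by
  induction φ with
  | tt => simp [Sat, ob]
  | atom a => simp [Sat, ob]
  | not φ ih => simp [Sat, ob, ih]
  | and φ ψ ihφ ihψ => simp [Sat, ob, ihφ, ihψ]
  | next φ ih => simp [Sat, ob, wsuffix_const, ih]
  | untl φ ψ _ ihψ =>
    simp only [Sat, ob, wsuffix_const, ihψ]
    exact ⟨fun ⟨_, h, _⟩ => h, fun h => ⟨0, h, by simp⟩⟩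
end
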